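/- The Euclidean space ℝⁿ has the invariance of domain property: if U, V ⊆ ℝⁿ are homeomorphic subsets, then U is open if and only if V is open. -/

import Mathlib

open MeasureTheory Metric Set

/-- Lagrange interpolation for the polynomial `t ↦ det (1 + t A)`. -/
theorem iod_det_interp (n : ℕ) (v : ℕ → ℝ) (hv : Function.Injective v) :
    ∃ w : ℕ → ℝ, (∑ i ∈ Finset.range (n + 1), w i = 1) ∧
      ∀ A : EuclideanSpace ℝ (Fin n) →L[ℝ] EuclideanSpace ℝ (Fin n),
        (1 + A).det = ∑ i ∈ Finset.range (n + 1), w i * (1 + v i • A).det := by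
  refine ⟨fun i => (Lagrange.basis (Finset.range (n + 1)) v i).eval 1, ?_, ?_⟩
  · rw [← Polynomial.eval_finsetSum, Lagrange.sum_basis hv.injOn (by simp)]
    simp
  · intro A
    set b := (EuclideanSpace.basisFun (Fin n) ℝ).toBasis
    set M := LinearMap.toMatrix b b (A : EuclideanSpace ℝ (Fin n) →ₗ[ℝ] EuclideanSpace ℝ (Fin n))
    set p : Polynomial ℝ := ((Polynomial.X : Polynomial ℝ) • M.map Polynomial.C
      + (1 : Matrix (Fin n) (Fin n) ℝ).map Polynomial.C).det with hp
    have hdeg : p.degree < (Finset.range (n + 1)).card := by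
      have := Polynomial.natDegree_det_X_add_C_le M 1
      rw [Finset.card_range]
      refine lt_of_le_of_lt Polynomial.degree_le_natDegree ?_
      rw [Fintype.card_fin] at this
      exact_mod_cast Nat.lt_succ_of_le this
    have heval : ∀ t : ℝ, p.eval t = (1 + t • A).det := by
      intro t
      have h1 : (1 + t • A).det = (1 + t • M).det := by
        rw [ContinuousLinearMap.det, ← LinearMap.det_toMatrix b]
        congr 1
        have : ((1 + t • A : EuclideanSpace ℝ (Fin n) →L[ℝ] EuclideanSpace ℝ (Fin n)) :
            EuclideanSpace ℝ (Fin n) →ₗ[ℝ] EuclideanSpace ℝ (Fin n)) =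
            LinearMap.id + t • (A : EuclideanSpace ℝ (Fin n) →ₗ[ℝ] EuclideanSpace ℝ (Fin n)) := rfl
        rw [this, map_add, map_smul, LinearMap.toMatrix_id]
      rw [h1, hp, ← Polynomial.coe_evalRingHom, RingHom.map_det]
      congr 1
      ext i j
      simp [Matrix.one_apply, add_comm]
      split_ifs <;> simp [mul_comm]
    have h := congrArg (Polynomial.eval 1) (Lagrange.eq_interpolate hv.injOn hdeg)
    rw [Lagrange.interpolate_apply, Polynomial.eval_finsetSum, heval 1, one_smul] at h
    rw [h]
    refine Finset.sum_congr rfl fun i _ => ?_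
    simp [heval, mul_comm]

theorem iod_lipschitz {n : ℕ} {R : ℝ}
    {G : EuclideanSpace ℝ (Fin n) → EuclideanSpace ℝ (Fin n)} {K : NNReal}
    (hG : LipschitzOnWith K G (closedBall 0 R)) (h0 : ∀ x, ‖x‖ = R → G x = 0) :
    LipschitzWith K ((closedBall 0 R).indicator G) := by
  have key : ∀ x y, x ∈ closedBall (0 : EuclideanSpace ℝ (Fin n)) R → y ∉ closedBall 0 R →
      dist (G x) 0 ≤ K * dist x y := by
    intro x y hx hy
    rw [mem_closedBall_zero_iff] at hx hy
    push Not at hy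
    have hc : ContinuousOn (fun t : ℝ => ‖AffineMap.lineMap x y t‖) (Icc 0 1) := by
      apply Continuous.continuousOn
      exact (AffineMap.lineMap_continuous).norm
    obtain ⟨t, ht, hz⟩ := intermediate_value_Icc zero_le_one hc
      (show R ∈ Icc _ _ by simpa using ⟨hx, hy.le⟩)
    have hz' : ‖AffineMap.lineMap x y t‖ = R := hz
    have := hG.dist_le_mul x (by simpa using hx) (AffineMap.lineMap x y t) (by simp [hz'])
    rw [h0 _ hz'] at this
    refine this.trans ?_
    gcongr
    rw [dist_left_lineMap, Real.norm_of_nonneg ht.1]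
    exact mul_le_of_le_one_left dist_nonneg ht.2
  refine LipschitzWith.of_dist_le_mul fun x y => ?_
  by_cases hx : x ∈ closedBall (0 : EuclideanSpace ℝ (Fin n)) R <;>
    by_cases hy : y ∈ closedBall (0 : EuclideanSpace ℝ (Fin n)) R
  · rw [indicator_of_mem hx, indicator_of_mem hy]; exact hG.dist_le_mul x hx y hy
  · rw [indicator_of_mem hx, indicator_of_notMem hy]; exact key x y hx hy
  · rw [indicator_of_notMem hx, indicator_of_mem hy, dist_comm, dist_comm x]; exact key y x hy hx
  · rw [indicator_of_notMem hx, indicator_of_notMem hy, dist_self]; positivity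

theorem iod_bij {n : ℕ} {g : EuclideanSpace ℝ (Fin n) → EuclideanSpace ℝ (Fin n)} {K : NNReal}
    (hg : LipschitzWith K g) (hK : K < 1) : Function.Bijective (fun x => x + g x) := by
  have h : ApproximatesLinearOn (fun x => x + g x)
      ((ContinuousLinearEquiv.refl ℝ (EuclideanSpace ℝ (Fin n)) :
        EuclideanSpace ℝ (Fin n) ≃L[ℝ] EuclideanSpace ℝ (Fin n)) :
        EuclideanSpace ℝ (Fin n) →L[ℝ] EuclideanSpace ℝ (Fin n)) univ K := by
    intro x _ y _
    have := hg.dist_le_mul x y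
    rw [dist_eq_norm, dist_eq_norm] at this
    have e : (x + g x) - (y + g y) - (x - y) = g x - g y := by abel
    change ‖(x + g x) - (y + g y) - (x - y)‖ ≤ _
    rw [e]
    exact this
  have hc : Subsingleton (EuclideanSpace ℝ (Fin n)) ∨ K <
    ‖((ContinuousLinearEquiv.refl ℝ (EuclideanSpace ℝ (Fin n))).symm :
        EuclideanSpace ℝ (Fin n) →L[ℝ] EuclideanSpace ℝ (Fin n))‖₊⁻¹ := by
    rcases subsingleton_or_nontrivial (EuclideanSpace ℝ (Fin n)) with h1 | h1
    · exact Or.inl h1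
    · right
      have : ‖((ContinuousLinearEquiv.refl ℝ (EuclideanSpace ℝ (Fin n))).symm :
        EuclideanSpace ℝ (Fin n) →L[ℝ] EuclideanSpace ℝ (Fin n))‖₊ = 1 := by
        rw [← NNReal.coe_inj]
        exact ContinuousLinearMap.norm_id
      rw [this]; simpa using hK
  exact ⟨injOn_univ.1 (h.injOn hc), h.surjective hc⟩

theorem iod_vol {n : ℕ} {R : ℝ}
    {G : EuclideanSpace ℝ (Fin n) → EuclideanSpace ℝ (Fin n)}
    (hG : ContDiff ℝ 1 G) (h0 : ∀ x, ‖x‖ = R → G x = 0) :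
    ∃ t₀ : ℝ, 0 < t₀ ∧ ∀ t, 0 < t → t < t₀ →
      ∫ x in ball (0 : EuclideanSpace ℝ (Fin n)) R, (1 + t • fderiv ℝ G x).det =
        volume.real (ball (0 : EuclideanSpace ℝ (Fin n)) R) := by
  obtain ⟨K, hK⟩ := hG.contDiffOn.exists_lipschitzOnWith one_ne_zero
    (convex_closedBall (0 : EuclideanSpace ℝ (Fin n)) R) (isCompact_closedBall _ _)
  have hbd : ∀ x ∈ ball (0 : EuclideanSpace ℝ (Fin n)) R, ‖fderiv ℝ G x‖ ≤ K := fun x hx =>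
    ((hG.differentiable one_ne_zero) x).hasFDerivAt.le_of_lipschitzOn
      (Filter.mem_of_superset (isOpen_ball.mem_nhds hx) ball_subset_closedBall) hK
  have hlip := iod_lipschitz hK h0
  obtain ⟨η, hη, hdet⟩ : ∃ η > 0, ∀ A : EuclideanSpace ℝ (Fin n) →L[ℝ] EuclideanSpace ℝ (Fin n),
      ‖A‖ < η → 0 < (1 + A).det := by
    have hc : Continuous fun A : EuclideanSpace ℝ (Fin n) →L[ℝ] EuclideanSpace ℝ (Fin n) =>
        (1 + A).det := ContinuousLinearMap.continuous_det.comp (by fun_prop)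
    have h1 : (0:ℝ) < (1 + 0 : EuclideanSpace ℝ (Fin n) →L[ℝ] EuclideanSpace ℝ (Fin n)).det := by
      rw [add_zero]
      have : (1 : EuclideanSpace ℝ (Fin n) →L[ℝ] EuclideanSpace ℝ (Fin n)).det = 1 :=
        LinearMap.det_id
      rw [this]; exact one_pos
    obtain ⟨η, hη, h⟩ := Metric.eventually_nhds_iff.1 (hc.continuousAt.eventually_const_lt h1)
    exact ⟨η, hη, fun A hA => h (by simpa using hA)⟩
  refine ⟨min 1 η / (K + 1), by positivity, fun t ht ht' => ?_⟩
  rw [lt_div_iff₀ (by positivity)] at ht'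
  have htK : t * K < min 1 η := by nlinarith
  have htK1 : t * K < 1 := htK.trans_le (min_le_left _ _)
  have htK2 : t * K < η := htK.trans_le (min_le_right _ _)
  set g := (closedBall (0 : EuclideanSpace ℝ (Fin n)) R).indicator G with hg
  have hlt : LipschitzWith (t.toNNReal * K) (fun x => t • g x) := by
    refine LipschitzWith.of_dist_le_mul fun x y => ?_
    rw [dist_smul₀, Real.norm_of_nonneg ht.le]
    push_cast
    rw [Real.coe_toNNReal _ ht.le, mul_assoc]
    have := hlip.dist_le_mul x y
    gcongr
  have hbij := iod_bij hlt (by rw [← NNReal.coe_lt_coe]; push_cast; rwa [Real.coe_toNNReal _ ht.le])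
  set F := fun x => x + t • g x with hF
  have hfix : ∀ x, x ∉ ball (0 : EuclideanSpace ℝ (Fin n)) R → F x = x := by
    intro x hx
    rw [mem_ball_zero_iff, not_lt] at hx
    have : g x = 0 := by
      rw [hg]
      by_cases h : x ∈ closedBall (0 : EuclideanSpace ℝ (Fin n)) R
      · rw [indicator_of_mem h]
        exact h0 x (le_antisymm (by simpa using h) hx)
      · exact indicator_of_notMem h _
    simp [hF, this]
  have himg : F '' ball 0 R = ball 0 R := by
    apply Subset.antisymm
    · rintro _ ⟨x, hx, rfl⟩
      by_contra h
      exact h ((hbij.1 (hfix _ h)).symm ▸ hx)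
    · intro y hy
      obtain ⟨x, rfl⟩ := hbij.2 y
      refine ⟨x, ?_, rfl⟩
      by_contra h
      rw [hfix x h] at hy
      exact h hy
  have hder : ∀ x ∈ ball (0 : EuclideanSpace ℝ (Fin n)) R,
      HasFDerivWithinAt F (1 + t • fderiv ℝ G x) (ball 0 R) x := by
    intro x hx
    have h1 : HasFDerivAt (fun x => x + t • G x) (1 + t • fderiv ℝ G x) x :=
      (hasFDerivAt_id x).add (((hG.differentiable one_ne_zero) x).hasFDerivAt.const_smul t)
    refine h1.hasFDerivWithinAt.congr (fun y hy => ?_) ?_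
    · simp [hF, hg, indicator_of_mem (ball_subset_closedBall hy)]
    · simp [hF, hg, indicator_of_mem (ball_subset_closedBall hx)]
  have hcv := integral_image_eq_integral_abs_det_fderiv_smul volume measurableSet_ball hder
    hbij.1.injOn (fun _ => (1 : ℝ))
  rw [himg] at hcv
  simp only [integral_const, smul_eq_mul, mul_one, measureReal_restrict_apply_univ] at hcv
  rw [hcv]
  refine setIntegral_congr_fun measurableSet_ball fun x hx => ?_
  refine (abs_of_pos (hdet _ ?_)).symm
  rw [norm_smul, Real.norm_of_nonneg ht.le]
  exact lt_of_le_of_lt (by gcongr; exact hbd x hx) htK2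

theorem iod_no_retraction {n : ℕ} {R : ℝ} (hR : 0 < R)
    {F : EuclideanSpace ℝ (Fin n) → EuclideanSpace ℝ (Fin n)}
    (hF : ContDiff ℝ 1 F) (h0 : ∀ x, F x ≠ 0) (h1 : ∀ x, ‖x‖ = R → F x = x) : False := by
  set H := fun x => (R / ‖F x‖) • F x with hH
  have hHn : ∀ x, ‖H x‖ = R := by
    intro x
    have := norm_pos_iff.2 (h0 x)
    rw [hH]
    simp only [norm_smul, norm_div, norm_norm, Real.norm_of_nonneg hR.le]
    field_simp
  have hHd : ContDiff ℝ 1 H :=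
    (contDiff_const.div (hF.norm ℝ h0) (fun x => norm_ne_zero_iff.2 (h0 x))).smul hF
  have hGd : ContDiff ℝ 1 (fun x => H x - x) := hHd.sub contDiff_id
  have hder : ∀ x, 1 + fderiv ℝ (fun x => H x - x) x = fderiv ℝ H x := by
    intro x
    have : fderiv ℝ (fun x => H x - x) x = fderiv ℝ H x - 1 :=
      (((hHd.differentiable one_ne_zero) x).hasFDerivAt.sub (hasFDerivAt_id x)).fderiv
    rw [this]; abel
  have hdet : ∀ x, (fderiv ℝ H x).det = 0 := by
    intro x
    by_contra hne
    have hd := ((hHd.differentiable one_ne_zero) x).hasFDerivAt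
    have h2 := hd.norm_sq
    have h3 : HasFDerivAt (fun x => ‖H x‖ ^ 2)
        (0 : EuclideanSpace ℝ (Fin n) →L[ℝ] ℝ) x := by
      simp only [hHn]; exact hasFDerivAt_const _ _
    have h4 := h2.unique h3
    have h5 := ((fderiv ℝ H x).toContinuousLinearEquivOfDetNeZero hne).surjective (H x)
    obtain ⟨v, hv⟩ := h5
    rw [ContinuousLinearMap.toContinuousLinearEquivOfDetNeZero_apply] at hv
    have h6 := DFunLike.congr_fun h4 v
    simp [hv, hHn, hR.ne'] at h6
  obtain ⟨t₀, ht₀, hvol⟩ := iod_vol hGd (R := R) (by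
    intro x hx
    simp [hH, h1 x hx, hx, hR.ne'])
  obtain ⟨w, hw1, hw⟩ := iod_det_interp n (fun i => t₀ / ((i : ℝ) + 2)) (by
    intro i j hij
    have hi : ((i : ℝ) + 2) ≠ 0 := by positivity
    have hj : ((j : ℝ) + 2) ≠ 0 := by positivity
    simp only at hij
    rw [div_eq_div_iff hi hj] at hij
    have := mul_left_cancel₀ ht₀.ne' hij
    have : (i : ℝ) = j := by linarith
    exact_mod_cast this)
  have hint : ∀ t : ℝ, IntegrableOn (fun x => (1 + t • fderiv ℝ (fun x => H x - x) x).det)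
      (ball (0 : EuclideanSpace ℝ (Fin n)) R) := by
    intro t
    have hc : Continuous (fun x => (1 + t • fderiv ℝ (fun x => H x - x) x).det) :=
      ContinuousLinearMap.continuous_det.comp
        (continuous_const.add ((hGd.continuous_fderiv one_ne_zero).const_smul t))
    exact (hc.continuousOn.integrableOn_compact (isCompact_closedBall _ _)).mono_set
      ball_subset_closedBall
  have hfin : ∫ x in ball (0 : EuclideanSpace ℝ (Fin n)) R, (1 + fderiv ℝ (fun x => H x - x) x).det
      = volume.real (ball (0 : EuclideanSpace ℝ (Fin n)) R) := by
    rw [setIntegral_congr_fun measurableSet_ball (fun x _ => hw (fderiv ℝ (fun x => H x - x) x))]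
    rw [integral_finsetSum _ (fun i _ => (hint _).const_mul _)]
    simp only [integral_const_mul]
    rw [Finset.sum_congr rfl (fun i _ => by
      rw [hvol _ (by positivity) (div_lt_self ht₀ (by linarith [(Nat.cast_nonneg i : (0:ℝ) ≤ i)]))])]
    rw [← Finset.sum_mul, hw1, one_mul]
  simp only [hder, hdet, integral_zero] at hfin
  have : 0 < volume.real (ball (0 : EuclideanSpace ℝ (Fin n)) R) :=
    ENNReal.toReal_pos (measure_ball_pos volume _ hR).ne' measure_ball_lt_top.ne
  linarith

theorem iod_zero {n : ℕ} {h : EuclideanSpace ℝ (Fin n) → EuclideanSpace ℝ (Fin n)}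
    (hc : ContinuousOn h (closedBall 0 1)) (hb : ∀ x ∈ closedBall 0 1, ‖h x - x‖ ≤ 1) :
    ∃ x ∈ closedBall 0 1, h x = 0 := by
  by_contra hne
  push Not at hne
  set p : EuclideanSpace ℝ (Fin n) → EuclideanSpace ℝ (Fin n) := fun x => (max 1 ‖x‖)⁻¹ • x with hp
  have hm : ∀ x : EuclideanSpace ℝ (Fin n), 0 < max 1 ‖x‖ := fun x =>
    lt_of_lt_of_le one_pos (le_max_left _ _)
  have hpb : ∀ x, p x ∈ closedBall 0 1 := by
    intro x
    rw [mem_closedBall_zero_iff, hp]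
    simp only [norm_smul, norm_inv, Real.norm_of_nonneg (hm x).le]
    rw [inv_mul_le_iff₀ (hm x), mul_one]
    exact le_max_right _ _
  have hpc : Continuous p :=
    ((continuous_const.max continuous_norm).inv₀ (fun x => (hm x).ne')).smul continuous_id
  have hhc : Continuous fun x => h (p x) := hc.comp_continuous hpc hpb
  set k : EuclideanSpace ℝ (Fin n) → EuclideanSpace ℝ (Fin n) :=
    fun x => (max 0 (2 - max 1 ‖x‖)) • (h (p x) - p x) with hk
  have hkc : Continuous k := by
    have : Continuous fun x : EuclideanSpace ℝ (Fin n) => max 0 (2 - max 1 ‖x‖) := by fun_prop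
    exact this.smul (hhc.sub hpc)
  have hknz : ∀ x, x + k x ≠ 0 := by
    intro x hx
    rcases le_or_gt ‖x‖ 1 with h1 | h1
    · have : p x = x := by simp [hp, max_eq_left h1]
      apply hne x (by simpa using h1)
      have h2 : (2 - 1 : ℝ) = 1 := by norm_num
      simpa [hk, this, max_eq_left h1, h2] using hx
    · have h2 : ‖x‖ = ‖k x‖ := by
        rw [← norm_neg x, neg_eq_of_add_eq_zero_right hx]
      have h3 : ‖k x‖ ≤ max 0 (2 - ‖x‖) * 1 := by
        rw [hk]
        simp only [norm_smul, Real.norm_of_nonneg (le_max_left (0:ℝ) _)]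
        rw [max_eq_right h1.le]
        gcongr
        exact hb _ (hpb x)
      have : max 0 (2 - ‖x‖) < 1 := max_lt one_pos (by linarith)
      linarith
  obtain ⟨kk, hkkd, hkka, hkks⟩ := hkc.exists_contDiff_approx 1
    (ε := fun x => ‖x + k x‖) (by fun_prop) (fun x => norm_pos_iff.2 (hknz x))
  refine iod_no_retraction (R := 2) two_pos (F := fun x => x + kk x) (contDiff_id.add hkkd) ?_ ?_
  · intro x hx
    have := hkka x
    rw [eq_neg_of_add_eq_zero_right hx, dist_eq_norm] at this
    rw [show -x - k x = -(x + k x) by abel, norm_neg] at this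
    exact lt_irrefl _ this
  · intro x hx
    have : k x = 0 := by simp [hk, hx]
    have : kk x = 0 := by
      by_contra h
      exact hkks h this
    simp [this]

theorem iod_nhds {n : ℕ} {f : EuclideanSpace ℝ (Fin n) → EuclideanSpace ℝ (Fin n)}
    (hc : ContinuousOn f (closedBall 0 1)) (hi : InjOn f (closedBall 0 1)) :
    f '' closedBall 0 1 ∈ nhds (f 0) := by
  by_contra hnot
  have : CompactSpace (closedBall (0 : EuclideanSpace ℝ (Fin n)) 1) :=
    isCompact_iff_compactSpace.1 (isCompact_closedBall _ _)
  have he : Topology.IsClosedEmbedding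
      (fun x : closedBall (0 : EuclideanSpace ℝ (Fin n)) 1 => f x) :=
    Continuous.isClosedEmbedding (by exact continuousOn_iff_continuous_domRestrict.1 hc)
      (by exact injOn_iff_injective.1 hi)
  obtain ⟨G, hG⟩ := ContinuousMap.exists_extension' he ⟨Subtype.val, continuous_subtype_val⟩
  have hGf : ∀ x ∈ closedBall (0 : EuclideanSpace ℝ (Fin n)) 1, G (f x) = x :=
    fun x hx => congrFun hG ⟨x, hx⟩
  have h00 : (0 : EuclideanSpace ℝ (Fin n)) ∈ closedBall (0 : EuclideanSpace ℝ (Fin n)) 1 := by simp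
  have hG0 : G (f 0) = 0 := hGf 0 h00
  obtain ⟨eps, heps, hGeps⟩ := Metric.continuousAt_iff.1 (G.continuous.continuousAt (x := f 0)) (1/10)
    (by norm_num)
  obtain ⟨ε, hε, rfl⟩ : ∃ ε > 0, eps = 3 * ε := ⟨eps / 3, by positivity, by ring⟩
  have hGs : ∀ y, dist y (f 0) < 3 * ε → ‖G y‖ < 1/10 := by
    intro y hy
    simpa [hG0] using hGeps hy
  obtain ⟨c, hcε, hcK⟩ : ∃ c, dist c (f 0) < ε ∧ c ∉ f '' closedBall 0 1 := by
    by_contra h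
    push Not at h
    exact hnot (Filter.mem_of_superset (ball_mem_nhds _ hε) h)
  have hKc : IsCompact (f '' closedBall 0 1) := (isCompact_closedBall _ _).image_of_continuousOn hc
  have hS : IsCompact (f '' closedBall 0 1 ∩ {y | ε ≤ dist y c}) :=
    hKc.inter_right (isClosed_le continuous_const (by fun_prop))
  obtain ⟨a, ha, haS⟩ := hS.exists_forall_le' (f := fun y => ‖G y‖)
    (by fun_prop) (a := 0) (by
      rintro _ ⟨⟨x, hx, rfl⟩, hy⟩
      rw [hGf x hx, norm_pos_iff]
      rintro rfl
      rw [mem_ofPred_eq, dist_comm] at hy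
      linarith)
  obtain ⟨δ, hδ, hδa, hδ1⟩ : ∃ δ > 0, 2 * δ ≤ a ∧ 2 * δ ≤ 1/10 :=
    ⟨min a (1/10) / 2, by positivity, by linarith [min_le_left a (1/10)],
      by linarith [min_le_right a (1/10)]⟩
  obtain ⟨P, hPd, hPa, -⟩ := G.continuous.exists_contDiff_approx 1
    (ε := fun _ => δ) continuous_const (fun _ => hδ)
  have hnull : volume (P '' sphere c ε) = 0 :=
    addHaar_image_eq_zero_of_differentiableOn_of_addHaar_eq_zero volume
      (hPd.differentiable (by norm_num)).differentiableOn
      (Measure.addHaar_sphere_of_ne_zero volume c hε.ne')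
  obtain ⟨z, hz, hzP⟩ : ∃ z, ‖z‖ < δ ∧ z ∉ P '' sphere c ε := by
    by_contra h
    push Not at h
    have h1 : ball 0 δ ⊆ P '' sphere c ε := fun z hz => h z (by simpa using hz)
    have h2 := measure_mono_null h1 hnull
    exact (measure_ball_pos volume _ hδ).ne' h2
  have hQ : ∀ y, ‖P y - z - G y‖ < 2 * δ := by
    intro y
    have := hPa y
    rw [dist_eq_norm] at this
    calc ‖P y - z - G y‖ = ‖(P y - G y) - z‖ := by congr 1; abel
      _ ≤ ‖P y - G y‖ + ‖z‖ := norm_sub_le _ _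
      _ < 2 * δ := by linarith
  set Φ : EuclideanSpace ℝ (Fin n) → EuclideanSpace ℝ (Fin n) :=
    fun y => c + (max (ε / ‖y - c‖) 1) • (y - c) with hΦ
  have hyc : ∀ x ∈ closedBall (0 : EuclideanSpace ℝ (Fin n)) 1, f x - c ≠ 0 := by
    intro x hx h
    exact hcK ⟨x, hx, sub_eq_zero.1 h⟩
  have hΦ1 : ∀ y, y - c ≠ 0 → ε ≤ dist y c → Φ y = y := by
    intro y hy hd
    rw [dist_eq_norm] at hd
    have : ε / ‖y - c‖ ≤ 1 := (div_le_one (norm_pos_iff.2 hy)).2 hd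
    simp [hΦ, max_eq_right this]
  have hΦ2 : ∀ y, y - c ≠ 0 → dist y c < ε → Φ y ∈ sphere c ε := by
    intro y hy hd
    rw [dist_eq_norm] at hd
    have hpos := norm_pos_iff.2 hy
    have : 1 ≤ ε / ‖y - c‖ := (one_le_div hpos).2 hd.le
    rw [mem_sphere, dist_eq_norm]
    simp only [hΦ, max_eq_left this, add_sub_cancel_left, norm_smul, norm_div, norm_norm,
      Real.norm_of_nonneg hε.le]
    field_simp
  obtain ⟨x, hx, hx0⟩ := iod_zero (h := fun x => P (Φ (f x)) - z) (by
      refine ContinuousOn.sub (hPd.continuous.comp_continuousOn ?_) continuousOn_const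
      have hs : ContinuousOn (fun x => f x - c) (closedBall 0 1) := hc.sub continuousOn_const
      have hm : ContinuousOn (fun x => max (ε / ‖f x - c‖) 1) (closedBall 0 1) :=
        ContinuousOn.sup (continuousOn_const.div hs.norm
          (fun x hx => norm_ne_zero_iff.2 (hyc x hx))) continuousOn_const
      exact continuousOn_const.add (hm.smul hs)) (by
      intro x hx
      rcases le_or_gt ε (dist (f x) c) with hd | hd
      · have := hQ (f x)
        rw [hΦ1 _ (hyc x hx) hd]
        rw [hGf x hx] at this
        linarith
      · have h1 := hΦ2 _ (hyc x hx) hd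
        have h2 := hQ (Φ (f x))
        have h3 : ‖G (Φ (f x))‖ < 1/10 := hGs _ (by
          have := dist_triangle (Φ (f x)) c (f 0)
          rw [mem_sphere] at h1
          linarith)
        have h4 : ‖G (f x)‖ < 1/10 := hGs _ (by
          have := dist_triangle (f x) c (f 0)
          linarith)
        rw [hGf x hx] at h4
        calc ‖P (Φ (f x)) - z - x‖ = ‖(P (Φ (f x)) - z - G (Φ (f x))) + (G (Φ (f x)) - x)‖ := by
              congr 1; abel
          _ ≤ ‖P (Φ (f x)) - z - G (Φ (f x))‖ + ‖G (Φ (f x)) - x‖ := norm_add_le _ _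
          _ ≤ ‖P (Φ (f x)) - z - G (Φ (f x))‖ + (‖G (Φ (f x))‖ + ‖x‖) := by
              gcongr; exact norm_sub_le _ _
          _ ≤ 1 := by linarith)
  rcases le_or_gt ε (dist (f x) c) with hd | hd
  · have h1 := hQ (f x)
    have h2 := haS (f x) ⟨⟨x, hx, rfl⟩, hd⟩
    simp only [hΦ1 _ (hyc x hx) hd] at hx0
    rw [hx0, zero_sub, norm_neg] at h1
    linarith
  · exact hzP ⟨Φ (f x), hΦ2 _ (hyc x hx) hd, sub_eq_zero.1 hx0⟩

theorem iod_open (n : ℕ) (U V : Set (EuclideanSpace ℝ (Fin n))) (e : U ≃ₜ V) (hU : IsOpen U) :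
    IsOpen V := by
  classical
  rw [isOpen_iff_mem_nhds]
  intro v hv
  set u : U := e.symm ⟨v, hv⟩ with hu
  obtain ⟨r, hr, hrU⟩ := Metric.nhds_basis_closedBall.mem_iff.1 (hU.mem_nhds u.2)
  have hmem : ∀ x ∈ closedBall (0 : EuclideanSpace ℝ (Fin n)) 1,
      (u : EuclideanSpace ℝ (Fin n)) + r • x ∈ U := by
    intro x hx
    apply hrU
    rw [mem_closedBall_zero_iff] at hx
    rw [mem_closedBall, dist_eq_norm, add_sub_cancel_left, norm_smul, Real.norm_of_nonneg hr.le]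
    exact mul_le_of_le_one_right hr.le hx
  set f : EuclideanSpace ℝ (Fin n) → EuclideanSpace ℝ (Fin n) := fun x =>
    if hx : (u : EuclideanSpace ℝ (Fin n)) + r • x ∈ U then (e ⟨_, hx⟩ : V) else 0 with hf
  have hfx : ∀ x (hx : x ∈ closedBall (0 : EuclideanSpace ℝ (Fin n)) 1),
      f x = e ⟨_, hmem x hx⟩ := fun x hx => dif_pos (hmem x hx)
  have h := iod_nhds (f := f) (by
    rw [continuousOn_iff_continuous_domRestrict]
    have : (closedBall (0 : EuclideanSpace ℝ (Fin n)) 1).domRestrict f =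
        fun x => ((e ⟨_, hmem x.1 x.2⟩ : V) : EuclideanSpace ℝ (Fin n)) := by
      funext x
      exact hfx x.1 x.2
    rw [this]
    refine continuous_subtype_val.comp (e.continuous.comp ?_)
    exact Continuous.subtype_mk (by fun_prop) _) (by
    intro x hx y hy hxy
    rw [hfx x hx, hfx y hy] at hxy
    have h1 := congrArg Subtype.val (e.injective (Subtype.ext hxy))
    exact smul_right_injective _ hr.ne' (add_left_cancel h1))
  have hf0 : f 0 = v := by
    rw [hfx 0 (by simp)]
    have : (⟨(u : EuclideanSpace ℝ (Fin n)) + r • 0, hmem 0 (by simp)⟩ : U) = u :=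
      Subtype.ext (by simp)
    rw [this, hu]
    simp
  rw [hf0] at h
  refine Filter.mem_of_superset h ?_
  rintro _ ⟨x, hx, rfl⟩
  rw [hfx x hx]
  exact Subtype.coe_prop _

/-- Brouwer's invariance of domain: if `U, V ⊆ ℝⁿ` are homeomorphic subsets, then
`U` is open iff `V` is open. -/
theorem euclidean_invariance_of_domain (n : ℕ)
    (U V : Set (EuclideanSpace ℝ (Fin n))) (h : Nonempty (U ≃ₜ V)) :
    IsOpen U ↔ IsOpen V := by
  obtain ⟨e⟩ := h
  exact ⟨iod_open n U V e, iod_open n V U e.symm⟩
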